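/- Let X ~ SN₂((θ,θ), R) with θ < 0 and ρ ∈ (-1,1). Then λ_L(u) = P(X₁ ≤ F₁⁻¹(u) | X₂ ≤ F₂⁻¹(u)) ~ u^{(1-ρ)/(1+ρ)} · ((1+ρ)/2) √((1+ρ)/(1-ρ)) (-π log u)^{-ρ/(1+ρ)} as u → 0⁺; in particular the rate has the same power of u as the symmetric bivariate normal case. -/

import Mathlib

open Real MeasureTheory Filter Set

noncomputable def stdNormalPdf (t : ℝ) : ℝ := (Real.sqrt (2 * π))⁻¹ * Real.exp (-t ^ 2 / 2)

noncomputable def stdNormalCdf (z : ℝ) : ℝ := ∫ t in Set.Iic z, stdNormalPdf t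

noncomputable def biNormalPdf (r : ℝ) (p : ℝ × ℝ) : ℝ :=
  (2 * π * Real.sqrt (1 - r ^ 2))⁻¹ *
    Real.exp (-(p.1 ^ 2 - 2 * r * p.1 * p.2 + p.2 ^ 2) / (2 * (1 - r ^ 2)))

noncomputable def biSkewNormalPdf (θ ρ : ℝ) (p : ℝ × ℝ) : ℝ :=
  2 * biNormalPdf ρ p * stdNormalCdf (θ * p.1 + θ * p.2)

noncomputable def skewNormalCdf (l z : ℝ) : ℝ :=
  ∫ t in Set.Iic z, 2 * stdNormalPdf t * stdNormalCdf (l * t)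

theorem stdNormalPdf_eq_gaussianPDFReal : stdNormalPdf = ProbabilityTheory.gaussianPDFReal 0 1 := by
  funext t
  simp [stdNormalPdf, ProbabilityTheory.gaussianPDFReal]

theorem integrable_stdNormalPdf : Integrable stdNormalPdf := by
  rw [stdNormalPdf_eq_gaussianPDFReal]
  exact ProbabilityTheory.integrable_gaussianPDFReal 0 1

theorem integral_stdNormalPdf : ∫ t, stdNormalPdf t = 1 := by
  rw [stdNormalPdf_eq_gaussianPDFReal]
  exact ProbabilityTheory.integral_gaussianPDFReal_eq_one 0 one_ne_zero

theorem stdNormalPdf_nonneg (t : ℝ) : 0 ≤ stdNormalPdf t := by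
  unfold stdNormalPdf
  positivity

theorem stdNormalCdf_nonneg (z : ℝ) : 0 ≤ stdNormalCdf z :=
  setIntegral_nonneg measurableSet_Iic fun t _ => stdNormalPdf_nonneg t

theorem stdNormalCdf_le_one (z : ℝ) : stdNormalCdf z ≤ 1 := by
  rw [← integral_stdNormalPdf]
  exact setIntegral_le_integral integrable_stdNormalPdf (Eventually.of_forall stdNormalPdf_nonneg)

theorem stdNormalCdf_monotone : Monotone stdNormalCdf := fun _ _ h =>
  setIntegral_mono_set integrable_stdNormalPdf.integrableOn
    (Eventually.of_forall stdNormalPdf_nonneg) (Iic_subset_Iic.2 h).eventuallyLE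

theorem stdNormalCdf_measurable : Measurable stdNormalCdf := stdNormalCdf_monotone.measurable

theorem tendsto_stdNormalCdf_atTop : Tendsto stdNormalCdf atTop (nhds 1) := by
  rw [← integral_stdNormalPdf]
  exact (aecover_Iic tendsto_id).integral_tendsto_of_countably_generated integrable_stdNormalPdf

theorem skewNormalPdf_nonneg (l t : ℝ) : 0 ≤ 2 * stdNormalPdf t * stdNormalCdf (l * t) :=
  mul_nonneg (mul_nonneg zero_le_two (stdNormalPdf_nonneg t)) (stdNormalCdf_nonneg _)

theorem integrable_skewNormalPdf (l : ℝ) :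
    Integrable fun t => 2 * stdNormalPdf t * stdNormalCdf (l * t) := by
  refine (integrable_stdNormalPdf.const_mul 2).mul_bdd (c := 1)
    (stdNormalCdf_measurable.comp (measurable_const_mul l)).aestronglyMeasurable
    (Eventually.of_forall fun t => ?_)
  rw [Real.norm_of_nonneg (stdNormalCdf_nonneg _)]
  exact stdNormalCdf_le_one _

theorem skewNormalCdf_monotone (l : ℝ) : Monotone (skewNormalCdf l) := fun _ _ h =>
  setIntegral_mono_set (integrable_skewNormalPdf l).integrableOn
    (Eventually.of_forall (skewNormalPdf_nonneg l)) (Iic_subset_Iic.2 h).eventuallyLE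

/-- Zooming in on a boundary point `c` at scale `T⁻¹`, with orientation reversed. -/
theorem setIntegral_eq_integral_rescaled {E : Type*} [NormedAddCommGroup E] [NormedSpace ℝ E]
    [MeasurableSpace E] [BorelSpace E] [FiniteDimensional ℝ E] (μ : Measure E)
    [μ.IsAddHaarMeasure] {S S₀ : Set E} (hS : MeasurableSet S) (hS₀ : MeasurableSet S₀)
    (f : E → ℝ) (c : E) {T : ℝ} (hT : 0 < T) (h : ∀ x, c - T⁻¹ • x ∈ S ↔ x ∈ S₀) :
    T ^ Module.finrank ℝ E * ∫ x in S, f x ∂μ = ∫ x in S₀, f (c - T⁻¹ • x) ∂μ := by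
  have h₁ := Measure.integral_comp_smul μ (fun y => S.indicator f (c - y)) T⁻¹
  rw [integral_sub_left_eq_self, integral_indicator hS] at h₁
  have h₂ : (fun x => S.indicator f (c - T⁻¹ • x)) =
      S₀.indicator fun x => f (c - T⁻¹ • x) := by
    funext x
    by_cases hx : x ∈ S₀
    · rw [indicator_of_mem hx, indicator_of_mem ((h x).2 hx)]
    · rw [indicator_of_notMem hx, indicator_of_notMem (mt (h x).1 hx)]
  rw [h₂, integral_indicator hS₀] at h₁
  rw [h₁, inv_pow, inv_inv, abs_of_pos (by positivity), smul_eq_mul]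

theorem integrableOn_exp_neg_mul_Ici {a : ℝ} (ha : 0 < a) :
    IntegrableOn (fun s : ℝ => exp (-(a * s))) (Ici 0) := by
  rw [integrableOn_Ici_iff_integrableOn_Ioi]
  simpa [neg_mul] using integrableOn_exp_mul_Ioi (neg_lt_zero.2 ha) 0

theorem integral_exp_neg_mul_Ici {a : ℝ} (ha : 0 < a) :
    ∫ s in Ici (0 : ℝ), exp (-(a * s)) = a⁻¹ := by
  rw [integral_Ici_eq_integral_Ioi]
  simpa [neg_mul, neg_div_neg_eq] using integral_exp_mul_Ioi (neg_lt_zero.2 ha) 0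

theorem tendsto_neg_sub_inv_mul_atBot (s : ℝ) :
    Tendsto (fun T : ℝ => -T - T⁻¹ * s) atTop atBot := by
  have h : Tendsto (fun T : ℝ => -(T⁻¹ * s)) atTop (nhds (-(0 * s))) :=
    (tendsto_inv_atTop_zero.mul_const s).neg
  simpa [sub_eq_add_neg] using tendsto_neg_atTop_atBot.atBot_add h

theorem tendsto_skewNormalCdf_rescaled {l : ℝ} (hl : l < 0) :
    Tendsto (fun T : ℝ => skewNormalCdf l (-T) * (T * exp (T ^ 2 / 2) * (√(2 * π) / 2)))
      atTop (nhds 1) := by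
  have key : Tendsto (fun T : ℝ => ∫ s in Ici (0 : ℝ),
      exp (-s - (T⁻¹ * s) ^ 2 / 2) * stdNormalCdf (l * (-T - T⁻¹ * s))) atTop
      (nhds (∫ s in Ici (0 : ℝ), exp (-(1 * s)))) := by
    refine tendsto_integral_filter_of_dominated_convergence (fun s => exp (-(1 * s)))
      (Eventually.of_forall fun T => ?_) (Eventually.of_forall fun T => ?_)
      (integrableOn_exp_neg_mul_Ici one_pos) (Eventually.of_forall fun s => ?_)
    · refine (Measurable.mul (by fun_prop)
        (stdNormalCdf_measurable.comp (by fun_prop))).aestronglyMeasurable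
    · refine Eventually.of_forall fun s => ?_
      rw [Real.norm_of_nonneg (mul_nonneg (exp_pos _).le (stdNormalCdf_nonneg _))]
      refine (mul_le_of_le_one_right (exp_pos _).le (stdNormalCdf_le_one _)).trans ?_
      exact exp_le_exp.2 (by nlinarith [sq_nonneg (T⁻¹ * s)])
    · have h₁ : Tendsto (fun T : ℝ => exp (-s - (T⁻¹ * s) ^ 2 / 2)) atTop
          (nhds (exp (-s - (0 * s) ^ 2 / 2))) :=
        (tendsto_const_nhds.sub (((tendsto_inv_atTop_zero.mul_const s).pow 2).div_const 2)).rexp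
      have h₂ : Tendsto (fun T : ℝ => stdNormalCdf (l * (-T - T⁻¹ * s))) atTop (nhds 1) :=
        tendsto_stdNormalCdf_atTop.comp
          ((tendsto_neg_sub_inv_mul_atBot s).const_mul_atBot_of_neg hl)
      simpa using h₁.mul h₂
  rw [integral_exp_neg_mul_Ici one_pos, inv_one] at key
  refine key.congr' ?_
  filter_upwards [eventually_gt_atTop 0] with T hT
  have h := setIntegral_eq_integral_rescaled volume (S := Iic (-T)) (S₀ := Ici 0)
    measurableSet_Iic measurableSet_Ici
    (fun t => 2 * stdNormalPdf t * stdNormalCdf (l * t)) (-T) hT (fun x => by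
      simp [hT])
  rw [Module.finrank_self, pow_one] at h
  change T * skewNormalCdf l (-T) = _ at h
  rw [show skewNormalCdf l (-T) * (T * exp (T ^ 2 / 2) * (√(2 * π) / 2)) =
    (exp (T ^ 2 / 2) * (√(2 * π) / 2)) * (T * skewNormalCdf l (-T)) by ring, h,
    ← integral_const_mul]
  refine setIntegral_congr_fun measurableSet_Ici fun s _ => ?_
  have h2 : √(2 * π) ≠ 0 := by positivity
  have he : exp (-s - (T⁻¹ * s) ^ 2 / 2) =
      exp (T ^ 2 / 2) * exp (-(-T - T⁻¹ * s) ^ 2 / 2) := by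
    rw [← exp_add]
    congr 1
    field_simp
    ring
  simp only [stdNormalPdf, smul_eq_mul, he]
  field_simp

theorem tendsto_biSkewNormal_rescaled {θ ρ : ℝ} (hθ : θ < 0) (hρ : -1 < ρ) (hρ' : ρ < 1) :
    Tendsto (fun T : ℝ => (∫ p in {p : ℝ × ℝ | p.1 ≤ -T ∧ p.2 ≤ -T}, biSkewNormalPdf θ ρ p) *
      (T ^ 2 * exp (T ^ 2 / (1 + ρ)) * (π * √(1 - ρ ^ 2) / (1 + ρ) ^ 2))) atTop (nhds 1) := by
  have hp : 0 < 1 + ρ := by linarith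
  have hm : 0 < 1 - ρ := by linarith
  have hr : 0 < 1 - ρ ^ 2 := by nlinarith
  have hq (x y : ℝ) : 0 ≤ x ^ 2 - 2 * ρ * x * y + y ^ 2 := by
    nlinarith [sq_nonneg (x - ρ * y), mul_nonneg hr.le (sq_nonneg y)]
  have hi : 0 < (1 + ρ)⁻¹ := inv_pos.2 hp
  have hS₀ : (volume : Measure (ℝ × ℝ)).restrict (Ici 0 ×ˢ Ici 0) =
      (volume.restrict (Ici (0 : ℝ))).prod (volume.restrict (Ici (0 : ℝ))) :=
    (Measure.prod_restrict _ _).symm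
  have key : Tendsto (fun T : ℝ => ∫ p in (Ici (0 : ℝ) ×ˢ Ici (0 : ℝ)),
      exp (-((1 + ρ)⁻¹ * (p.1 + p.2)) - ((T⁻¹ * p.1) ^ 2 - 2 * ρ * (T⁻¹ * p.1) * (T⁻¹ * p.2)
        + (T⁻¹ * p.2) ^ 2) / (2 * (1 - ρ ^ 2))) *
      stdNormalCdf (θ * (-T - T⁻¹ * p.1) + θ * (-T - T⁻¹ * p.2))) atTop
      (nhds (∫ p in (Ici (0 : ℝ) ×ˢ Ici (0 : ℝ)),
        exp (-((1 + ρ)⁻¹ * p.1)) * exp (-((1 + ρ)⁻¹ * p.2)))) := by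
    refine tendsto_integral_filter_of_dominated_convergence
      (fun p => exp (-((1 + ρ)⁻¹ * p.1)) * exp (-((1 + ρ)⁻¹ * p.2)))
      (Eventually.of_forall fun T => ?_) (Eventually.of_forall fun T => ?_)
      ?_ (Eventually.of_forall fun p => ?_)
    · refine (Measurable.mul (by fun_prop)
        (stdNormalCdf_measurable.comp (by fun_prop))).aestronglyMeasurable
    · refine Eventually.of_forall fun p => ?_
      rw [Real.norm_of_nonneg (mul_nonneg (exp_pos _).le (stdNormalCdf_nonneg _)), ← exp_add]
      refine (mul_le_of_le_one_right (exp_pos _).le (stdNormalCdf_le_one _)).trans ?_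
      refine exp_le_exp.2 ?_
      have := div_nonneg (hq (T⁻¹ * p.1) (T⁻¹ * p.2)) (mul_pos two_pos hr).le
      linarith
    · rw [hS₀]
      exact (integrableOn_exp_neg_mul_Ici hi).mul_prod (integrableOn_exp_neg_mul_Ici hi)
    · have h₀ (s : ℝ) : Tendsto (fun T : ℝ => T⁻¹ * s) atTop (nhds 0) := by
        simpa using tendsto_inv_atTop_zero.mul_const s
      have h₁ : Tendsto (fun T : ℝ => exp (-((1 + ρ)⁻¹ * (p.1 + p.2)) -
          ((T⁻¹ * p.1) ^ 2 - 2 * ρ * (T⁻¹ * p.1) * (T⁻¹ * p.2) + (T⁻¹ * p.2) ^ 2) /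
            (2 * (1 - ρ ^ 2)))) atTop
          (nhds (exp (-((1 + ρ)⁻¹ * (p.1 + p.2)) -
            (0 ^ 2 - 2 * ρ * 0 * 0 + 0 ^ 2) / (2 * (1 - ρ ^ 2))))) :=
        (tendsto_const_nhds.sub (((((h₀ p.1).pow 2).sub
          (((h₀ p.1).const_mul (2 * ρ)).mul (h₀ p.2))).add ((h₀ p.2).pow 2)).div_const _)).rexp
      have h₂ : Tendsto (fun T : ℝ =>
          stdNormalCdf (θ * (-T - T⁻¹ * p.1) + θ * (-T - T⁻¹ * p.2))) atTop (nhds 1) :=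
        tendsto_stdNormalCdf_atTop.comp
          (((tendsto_neg_sub_inv_mul_atBot p.1).const_mul_atBot_of_neg hθ).atTop_add_atTop
            ((tendsto_neg_sub_inv_mul_atBot p.2).const_mul_atBot_of_neg hθ))
      have h₃ := h₁.mul h₂
      rwa [show exp (-((1 + ρ)⁻¹ * (p.1 + p.2)) -
            (0 ^ 2 - 2 * ρ * 0 * 0 + 0 ^ 2) / (2 * (1 - ρ ^ 2))) * 1 =
          exp (-((1 + ρ)⁻¹ * p.1)) * exp (-((1 + ρ)⁻¹ * p.2)) by
        rw [← exp_add, mul_one]; congr 1; ring] at h₃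
  rw [hS₀, integral_prod_mul (fun s => exp (-((1 + ρ)⁻¹ * s))) (fun s => exp (-((1 + ρ)⁻¹ * s))),
    integral_exp_neg_mul_Ici hi, inv_inv, ← hS₀] at key
  have key' := key.div_const ((1 + ρ) * (1 + ρ))
  rw [div_self (by positivity)] at key'
  refine key'.congr' ?_
  filter_upwards [eventually_gt_atTop 0] with T hT
  have h := setIntegral_eq_integral_rescaled volume
    (S := {p : ℝ × ℝ | p.1 ≤ -T ∧ p.2 ≤ -T}) (S₀ := Ici 0 ×ˢ Ici 0)
    ((measurableSet_le measurable_fst measurable_const).inter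
      (measurableSet_le measurable_snd measurable_const))
    (measurableSet_Ici.prod measurableSet_Ici)
    (biSkewNormalPdf θ ρ) (-T, -T) hT (fun x => by simp [hT, Prod.le_def])
  rw [Module.finrank_prod, Module.finrank_self, one_add_one_eq_two] at h
  rw [show ∀ J : ℝ, J * (T ^ 2 * exp (T ^ 2 / (1 + ρ)) * (π * √(1 - ρ ^ 2) / (1 + ρ) ^ 2)) =
    (exp (T ^ 2 / (1 + ρ)) * (π * √(1 - ρ ^ 2) / (1 + ρ) ^ 2)) * (T ^ 2 * J) by intro J; ring, h,
    ← integral_const_mul, ← integral_div]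
  refine setIntegral_congr_fun (measurableSet_Ici.prod measurableSet_Ici) fun p _ => ?_
  have h2 : √(1 - ρ ^ 2) ≠ 0 := by positivity
  have he : exp (-((1 + ρ)⁻¹ * (p.1 + p.2)) - ((T⁻¹ * p.1) ^ 2 -
        2 * ρ * (T⁻¹ * p.1) * (T⁻¹ * p.2) + (T⁻¹ * p.2) ^ 2) / (2 * (1 - ρ ^ 2))) =
      exp (T ^ 2 / (1 + ρ)) * exp (-((-T - T⁻¹ * p.1) ^ 2 -
        2 * ρ * (-T - T⁻¹ * p.1) * (-T - T⁻¹ * p.2) + (-T - T⁻¹ * p.2) ^ 2) /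
          (2 * (1 - ρ ^ 2))) := by
    rw [← exp_add]
    congr 1
    rw [show 1 - ρ ^ 2 = (1 - ρ) * (1 + ρ) by ring]
    field_simp
    ring
  simp only [biSkewNormalPdf, biNormalPdf, he, Prod.fst_sub, Prod.snd_sub, Prod.smul_fst,
    Prod.smul_snd, smul_eq_mul]
  field_simp

theorem tendsto_neg_quantile_atTop {l : ℝ} (hl : l < 0) {Q : ℝ → ℝ}
    (hQ : ∀ u ∈ Ioo (0 : ℝ) 1, skewNormalCdf l (Q u) = u) :
    Tendsto (fun u => -Q u) (nhdsWithin 0 (Ioi 0)) atTop := by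
  refine tendsto_atTop.2 fun M => ?_
  obtain ⟨T, hT, hM, hT0⟩ := ((tendsto_skewNormalCdf_rescaled hl).eventually
    (lt_mem_nhds zero_lt_one)|>.and ((eventually_ge_atTop M).and (eventually_gt_atTop 0))).exists
  have hpos : 0 < skewNormalCdf l (-T) := pos_of_mul_pos_left hT (by positivity)
  filter_upwards [Ioo_mem_nhdsGT (lt_min hpos one_pos)] with u hu
  have hu' := lt_min_iff.1 hu.2
  by_contra! hlt
  have := skewNormalCdf_monotone l (show -T ≤ Q u by linarith)
  rw [hQ u ⟨hu.1, hu'.2⟩] at this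
  linarith

/-- If `u ~ √(2/π) T⁻¹ exp (-T²/2)`, then `-π log u ~ π T² / 2`. -/
theorem tendsto_neg_pi_mul_log_div {α : Type*} {f : Filter α} {u T : α → ℝ}
    (hT : Tendsto T f atTop) (hu : ∀ᶠ x in f, 0 < u x)
    (h : Tendsto (fun x => u x * (T x * exp (T x ^ 2 / 2) * (√(2 * π) / 2))) f (nhds 1)) :
    Tendsto (fun x => -(π * log (u x)) / (π * T x ^ 2 / 2)) f (nhds 1) := by
  have hsq : Tendsto (fun x => T x ^ 2) f atTop := (tendsto_pow_atTop two_ne_zero).comp hT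
  have hlog : Tendsto (fun x => log (u x * (T x * exp (T x ^ 2 / 2) * (√(2 * π) / 2))) / T x ^ 2)
      f (nhds 0) := (h.log one_ne_zero).div_atTop hsq
  have hlogT : Tendsto (fun x => log (T x) / T x ^ 2) f (nhds 0) := by
    have : Tendsto (fun t : ℝ => log t / t ^ 2) atTop (nhds 0) := by
      simpa using (isLittleO_log_rpow_atTop (r := 2) two_pos).tendsto_div_nhds_zero
    exact this.comp hT
  have hc : Tendsto (fun x => log (√(2 * π) / 2) / T x ^ 2) f (nhds 0) :=
    tendsto_const_nhds.div_atTop hsq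
  have hsum := (((hlogT.add hc).sub hlog).const_mul 2).const_add 1
  norm_num at hsum
  refine hsum.congr' ?_
  filter_upwards [hu, hT.eventually_gt_atTop 0] with x hux hTx
  rw [log_mul hux.ne' (by positivity), log_mul (by positivity) (by positivity),
    log_mul hTx.ne' (exp_pos _).ne', log_exp]
  field_simp
  ring

theorem tail_ratio_eq {ρ u T J : ℝ} (hρ : -1 < ρ) (hρ' : ρ < 1) (hu : 0 < u) (hu' : u < 1)
    (hT : 0 < T) :
    J / u / (u ^ ((1 - ρ) / (1 + ρ)) * ((1 + ρ) / 2) * √((1 + ρ) / (1 - ρ)) *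
        (-(π * log u)) ^ (-ρ / (1 + ρ))) =
      J * (T ^ 2 * exp (T ^ 2 / (1 + ρ)) * (π * √(1 - ρ ^ 2) / (1 + ρ) ^ 2)) /
        ((u * (T * exp (T ^ 2 / 2) * (√(2 * π) / 2))) ^ (2 / (1 + ρ)) *
          (-(π * log u) / (π * T ^ 2 / 2)) ^ (-ρ / (1 + ρ))) := by
  have hp : 0 < 1 + ρ := by linarith
  have hm : 0 < 1 - ρ := by linarith
  have hL : 0 < -(π * log u) := by nlinarith [log_neg hu hu', pi_pos]
  have hW : 0 < π * T ^ 2 / 2 := by positivity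
  have hroot : T * exp (T ^ 2 / 2) * (√(2 * π) / 2) =
      (π * T ^ 2 / 2) ^ (1 / 2 : ℝ) * exp (T ^ 2 / 2) := by
    rw [← sqrt_eq_rpow, show π * T ^ 2 / 2 = (2 * π) * (T / 2) ^ 2 by ring,
      sqrt_mul (by positivity) ((T / 2) ^ 2), sqrt_sq (by positivity)]
    ring
  have hA : (u * (T * exp (T ^ 2 / 2) * (√(2 * π) / 2))) ^ (2 / (1 + ρ)) =
      u * u ^ ((1 - ρ) / (1 + ρ)) * ((π * T ^ 2 / 2) ^ (1 / (1 + ρ)) *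
        exp (T ^ 2 / (1 + ρ))) := by
    rw [hroot, mul_rpow hu.le (by positivity), mul_rpow (by positivity) (exp_pos _).le,
      ← rpow_mul hW.le, ← exp_mul]
    congr 1
    · rw [← rpow_one_add' hu.le (by positivity)]
      congr 1
      field_simp
      ring
    · congr 2 <;> field_simp
  have hWW : (π * T ^ 2 / 2) ^ (1 / (1 + ρ)) =
      (π * T ^ 2 / 2) * (π * T ^ 2 / 2) ^ (-ρ / (1 + ρ)) := by
    rw [← rpow_one_add' hW.le (by
      rw [show 1 + -ρ / (1 + ρ) = 1 / (1 + ρ) by field_simp; ring]; positivity)]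
    congr 1
    field_simp
    ring
  have hK : √((1 + ρ) / (1 - ρ)) = (1 + ρ) / √(1 - ρ ^ 2) := by
    rw [show (1 + ρ) / (1 - ρ) = (1 + ρ) ^ 2 / (1 - ρ ^ 2) by
      rw [show 1 - ρ ^ 2 = (1 - ρ) * (1 + ρ) by ring]; field_simp,
      sqrt_div (by positivity), sqrt_sq hp.le]
  have hr : 0 < √(1 - ρ ^ 2) := sqrt_pos.2 (by nlinarith)
  rw [hA, hWW, div_rpow hL.le hW.le, hK]
  have h₁ := rpow_pos_of_pos hW (-ρ / (1 + ρ))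
  have h₂ := rpow_pos_of_pos hL (-ρ / (1 + ρ))
  have h₃ := rpow_pos_of_pos hu ((1 - ρ) / (1 + ρ))
  have h₄ := exp_pos (T ^ 2 / (1 + ρ))
  generalize (π * T ^ 2 / 2) ^ (-ρ / (1 + ρ)) = w at *
  generalize (-(π * log u)) ^ (-ρ / (1 + ρ)) = v at *
  generalize u ^ ((1 - ρ) / (1 + ρ)) = y at *
  generalize exp (T ^ 2 / (1 + ρ)) = e at *
  field_simp

/-- Rate of decay of lower tail dependence for the equi-skew bivariate skew normal, θ < 0:
λ_L(u) ~ u^{(1-ρ)/(1+ρ)} ((1+ρ)/2) √((1+ρ)/(1-ρ)) (-π log u)^{-ρ/(1+ρ)} as u → 0⁺,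
the same power of u as in the symmetric bivariate normal case. -/
theorem biSkewNormal_tail_dependence_neg (θ ρ : ℝ) (hθ : θ < 0) (hρ : -1 < ρ) (hρ' : ρ < 1)
    (l : ℝ) (hl : l = θ * (1 + ρ) / Real.sqrt (1 + θ ^ 2 * (1 - ρ ^ 2)))
    (Q : ℝ → ℝ) (hQ : ∀ u ∈ Set.Ioo (0 : ℝ) 1, skewNormalCdf l (Q u) = u) :
    Tendsto (fun u : ℝ =>
      ((∫ p in {p : ℝ × ℝ | p.1 ≤ Q u ∧ p.2 ≤ Q u}, biSkewNormalPdf θ ρ p) / u) /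
      (u ^ ((1 - ρ) / (1 + ρ)) * ((1 + ρ) / 2) * Real.sqrt ((1 + ρ) / (1 - ρ)) *
        (-(π * Real.log u)) ^ (-ρ / (1 + ρ))))
      (nhdsWithin 0 (Set.Ioi 0)) (nhds 1) := by
  have hp : 0 < 1 + ρ := by linarith
  have hl0 : l < 0 := by
    have hr : 0 < 1 - ρ ^ 2 := by nlinarith
    rw [hl]
    exact div_neg_of_neg_of_pos (mul_neg_of_neg_of_pos hθ hp) (by positivity)
  have hT := tendsto_neg_quantile_atTop hl0 hQ
  have hu : ∀ᶠ u : ℝ in nhdsWithin 0 (Ioi 0), u ∈ Ioo (0 : ℝ) 1 := Ioo_mem_nhdsGT one_pos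
  have hA : Tendsto (fun u : ℝ => u * (-Q u * exp ((-Q u) ^ 2 / 2) * (√(2 * π) / 2)))
      (nhdsWithin 0 (Ioi 0)) (nhds 1) := by
    refine ((tendsto_skewNormalCdf_rescaled hl0).comp hT).congr' ?_
    filter_upwards [hu] with u hu
    simp only [Function.comp_apply, neg_neg, hQ u hu]
  have hB := (tendsto_biSkewNormal_rescaled hθ hρ hρ').comp hT
  have hC := tendsto_neg_pi_mul_log_div hT (hu.mono fun _ h => h.1) hA
  have hlim := hB.div ((hA.rpow_const (p := 2 / (1 + ρ)) (Or.inl one_ne_zero)).mul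
    (hC.rpow_const (p := -ρ / (1 + ρ)) (Or.inl one_ne_zero))) (by simp)
  simp only [one_rpow, mul_one, div_one] at hlim
  refine hlim.congr' ?_
  filter_upwards [hu, hT.eventually_gt_atTop 0] with u hu hTu
  rw [tail_ratio_eq hρ hρ' hu.1 hu.2 hTu]
  simp only [Pi.div_apply, Function.comp_apply, neg_neg]
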